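/- arXiv:2503.04583 — 2 statements merged into one kernel-verified Lean document; each statement's English description precedes it below -/
import Mathlib

section
/- Let G be a network (a finite, strongly connected directed multigraph without self-loops) with a deadlock-free routing scheme, and let ≤ be a linear order on the edge set E that respects the routing scheme, with attraction number s and attraction subgraph G_s. If G_s has more than one global attractor, then there exists another linear order ≤' on E that respects the routing scheme and whose attraction number is strictly smaller than s. -/
/-- `p` is a directed path from `u` to `w` in the directed multigraph given by
`src, tgt : E → V`: a nonempty list of edges where the target of each edge equals the
source of the next, starting at `u` and ending at `w`. -/
def IsPathFrom {V E : Type*} (src tgt : E → V) (u w : V) (p : List E) : Prop :=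
  p ≠ [] ∧ p.Chain' (fun e₁ e₂ => tgt e₁ = src e₂) ∧
    p.head?.map src = some u ∧ p.getLast?.map tgt = some w

/-- `w` is reachable from `u` by a directed path using only edges from `A`. -/
def ReachableVia {V E : Type*} (src tgt : E → V) (A : Set E) (u w : V) : Prop :=
  ∃ p : List E, (∀ e ∈ p, e ∈ A) ∧ IsPathFrom src tgt u w p

/-- The graph is strongly connected: every vertex reaches every other vertex. -/
def StronglyConnected {V E : Type*} (src tgt : E → V) : Prop :=
  ∀ u w : V, u ≠ w → ReachableVia src tgt Set.univ u w

/-- `route` is a routing scheme: it assigns to every ordered pair of distinct vertices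
a directed path between them. -/
def IsRouting {V E : Type*} (src tgt : E → V) (route : ∀ u w : V, u ≠ w → List E) : Prop :=
  ∀ (u w : V) (h : u ≠ w), IsPathFrom src tgt u w (route u w h)

/-- The dependency relation of a routing scheme: `Dep route e₁ e₂` iff `e₂` immediately
follows `e₁` on some routing path. -/
def Dep {V E : Type*} (route : ∀ u w : V, u ≠ w → List E) (e₁ e₂ : E) : Prop :=
  ∃ (u w : V) (h : u ≠ w), [e₁, e₂] <:+: route u w h

/-- A routing scheme is deadlock-free iff its dependency relation is acyclic. -/
def DeadlockFree {V E : Type*} (route : ∀ u w : V, u ≠ w → List E) : Prop :=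
  Irreflexive (Relation.TransGen (Dep route))

/-- `T` is a spanning in-tree rooted at `v`: it has exactly `|V| - 1` edges and every
vertex other than `v` has a directed path to `v` using only edges of `T`. -/
def IsInTree {V E : Type*} [Fintype V] (src tgt : E → V) (v : V) (T : Finset E) : Prop :=
  T.card = Fintype.card V - 1 ∧ ∀ u : V, u ≠ v → ReachableVia src tgt ↑T u v

/-- `T` is a spanning out-tree rooted at `v`: it has exactly `|V| - 1` edges and every
vertex other than `v` is reachable from `v` by a directed path using only edges of `T`. -/
def IsOutTree {V E : Type*} [Fintype V] (src tgt : E → V) (v : V) (T : Finset E) : Prop :=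
  T.card = Fintype.card V - 1 ∧ ∀ w : V, w ≠ v → ReachableVia src tgt ↑T v w

/-- A linear order on `E` respects a routing scheme if `e₁ < e₂` whenever `e₂`
immediately follows `e₁` on some routing path. -/
def RespectsRouting {V E : Type*} (route : ∀ u w : V, u ≠ w → List E)
    (ord : LinearOrder E) : Prop :=
  ∀ e₁ e₂ : E, Dep route e₁ e₂ → ord.lt e₁ e₂

/-- The set of the `s` smallest edges of a linear order on `E`. -/
def smallestEdges {E : Type*} (ord : LinearOrder E) (s : ℕ) : Set E :=
  {e | {e' | ord.le e' e}.ncard ≤ s}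

/-- `v` is a global attractor of the subgraph with edge set `A`: it is reachable from
every other vertex by a directed path using only edges of `A`. -/
def IsGlobalAttractor {V E : Type*} (src tgt : E → V) (A : Set E) (v : V) : Prop :=
  ∀ u : V, u ≠ v → ReachableVia src tgt A u v

/-- The attraction number of a linear order on `E`: the least `s` such that the subgraph
consisting of the `s` smallest edges has a global attractor. -/
noncomputable def attractionNumber {V E : Type*} (src tgt : E → V) (ord : LinearOrder E) : ℕ :=
  sInf {s | ∃ v : V, IsGlobalAttractor src tgt (smallestEdges ord s) v}

/-- There is an edge from `x` to `y` in the edge set `A`. -/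
def EdgeStep {V E : Type*} (src tgt : E → V) (A : Set E) (x y : V) : Prop :=
  ∃ e ∈ A, src e = x ∧ tgt e = y

section Reachability

variable {V E : Type*} {src tgt : E → V} {A B : Set E} {u v w : V}

theorem isPathFrom_singleton (e : E) : IsPathFrom src tgt (src e) (tgt e) [e] := by
  simp [IsPathFrom, List.Chain']

theorem isPathFrom_cons_cons {e f : E} {p : List E} :
    IsPathFrom src tgt u w (e :: f :: p) ↔
      src e = u ∧ IsPathFrom src tgt (tgt e) w (f :: p) := by
  simp only [IsPathFrom, List.head?_cons, Option.map_some, Option.some.injEq,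
    List.getLast?_cons_cons, List.isChain_cons_cons, ne_eq, reduceCtorEq, not_false_eq_true,
    true_and, List.Chain']
  grind

theorem reachableVia_iff_transGen :
    ReachableVia src tgt A u w ↔ Relation.TransGen (EdgeStep src tgt A) u w := by
  constructor
  · rintro ⟨p, hA, hp⟩
    induction p generalizing u with
    | nil => exact absurd rfl hp.1
    | cons e p ih =>
      have he : e ∈ A := hA e (by simp)
      cases p with
      | nil =>
        obtain ⟨-, -, hu, hw⟩ := hp
        exact .single ⟨e, he, by simpa using hu, by simpa using hw⟩
      | cons f p =>
        rw [isPathFrom_cons_cons] at hp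
        exact .head ⟨e, he, hp.1, rfl⟩ (ih (fun x hx => hA x (List.mem_cons_of_mem _ hx)) hp.2)
  · intro h
    induction h using Relation.TransGen.head_induction_on with
    | single h =>
      obtain ⟨e, he, rfl, rfl⟩ := h
      exact ⟨[e], by simpa using he, isPathFrom_singleton e⟩
    | head h _ ih =>
      obtain ⟨e, he, rfl, rfl⟩ := h
      obtain ⟨p, hA, hp⟩ := ih
      cases p with
      | nil => exact absurd rfl hp.1
      | cons f p =>
        exact ⟨e :: f :: p, List.forall_mem_cons.2 ⟨he, hA⟩, isPathFrom_cons_cons.2 ⟨rfl, hp⟩⟩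

theorem ReachableVia.exists_edge_src (h : ReachableVia src tgt A u w) : ∃ e ∈ A, src e = u := by
  obtain ⟨_, ⟨e, he, hu, -⟩, -⟩ :=
    Relation.TransGen.head'_iff.1 (reachableVia_iff_transGen.1 h)
  exact ⟨e, he, hu⟩

/-- A path to `w` can be cut at its first visit to `w`, so it needs no edges leaving `w`. -/
theorem ReachableVia.of_edges_leaving_target (hAB : ∀ e ∈ A, src e ≠ w → e ∈ B) (huw : u ≠ w)
    (h : ReachableVia src tgt A u w) : ReachableVia src tgt B u w := by
  rw [reachableVia_iff_transGen] at h ⊢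
  induction h using Relation.TransGen.head_induction_on with
  | single h =>
    obtain ⟨e, he, rfl, rfl⟩ := h
    exact .single ⟨e, hAB e he huw, rfl, rfl⟩
  | head h _ ih =>
    obtain ⟨e, he, rfl, rfl⟩ := h
    have hstep : EdgeStep src tgt B (src e) (tgt e) := ⟨e, hAB e he huw, rfl, rfl⟩
    by_cases hw : tgt e = w
    · exact .single (hw ▸ hstep)
    · exact .head hstep (ih hw)

theorem IsGlobalAttractor.of_edges_leaving (hAB : ∀ e ∈ A, src e ≠ v → e ∈ B)
    (h : IsGlobalAttractor src tgt A v) : IsGlobalAttractor src tgt B v :=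
  fun u hu => (h u hu).of_edges_leaving_target hAB hu

theorem IsGlobalAttractor.tgt_of_src {e : E} (he : e ∈ A) (h : IsGlobalAttractor src tgt A (src e)) :
    IsGlobalAttractor src tgt A (tgt e) := by
  intro u _
  have hstep : EdgeStep src tgt A (src e) (tgt e) := ⟨e, he, rfl, rfl⟩
  rw [reachableVia_iff_transGen]
  by_cases hu : u = src e
  · exact hu ▸ .single hstep
  · exact (reachableVia_iff_transGen.1 (h u hu)).tail hstep

theorem IsPathFrom.tgt_eq_src_of_infix {p : List E} {e f : E} (hp : IsPathFrom src tgt u w p)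
    (h : [e, f] <:+: p) : tgt e = src f := by
  simpa using List.IsChain.infix hp.2.1 h

end Reachability

section Orders

variable {E : Type*}

theorem mem_smallestEdges_of_le [Finite E] {ord : LinearOrder E} {s : ℕ} {e f : E}
    (h : ord.le e f) (hf : f ∈ smallestEdges ord s) : e ∈ smallestEdges ord s :=
  (Set.ncard_le_ncard (fun _ hx => ord.le_trans _ _ _ hx h) (Set.toFinite _)).trans hf

theorem ncard_smallestEdges_le [Finite E] (ord : LinearOrder E) (s : ℕ) :
    (smallestEdges ord s).ncard ≤ s := by
  rcases (smallestEdges ord s).eq_empty_or_nonempty with h | h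
  · simp [h]
  · obtain ⟨m, hm, hmax⟩ := Set.exists_max_image _ id (Set.toFinite _) h
    exact (Set.ncard_le_ncard hmax (Set.toFinite _)).trans hm

/-- For every subset `D` of a linear order there is a linear order which puts `D` first and is
unchanged inside `D` and inside its complement. -/
theorem exists_linearOrder_initial (ord : LinearOrder E) (D : Set E) :
    ∃ ord' : LinearOrder E, (∀ x y, ord'.le x y → y ∈ D → x ∈ D) ∧
      ∀ x y, ord.lt x y → (y ∈ D → x ∈ D) → ord'.lt x y := by
  classical
  let φ : E → Bool ×ₗ E := fun e => toLex (decide (e ∉ D), e)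
  have hφ : Function.Injective φ := fun x y h => congrArg (fun z => (ofLex z).2) h
  refine ⟨LinearOrder.lift' φ hφ, fun x y h hy => ?_, fun x y h hD => ?_⟩
  · have h' : φ x ≤ φ y := h
    by_contra hx
    simp [φ, Prod.Lex.toLex_le_toLex, hx, hy] at h'
    exact absurd h' (by decide)
  · change φ x < φ y
    by_cases hx : x ∈ D <;> by_cases hy : y ∈ D <;>
      simp_all [φ, Prod.Lex.toLex_lt_toLex]

theorem subset_smallestEdges_ncard [Finite E] {ord : LinearOrder E} {D : Set E}
    (hD : ∀ x y, ord.le x y → y ∈ D → x ∈ D) : D ⊆ smallestEdges ord D.ncard :=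
  fun e he => Set.ncard_le_ncard (fun x hx => hD x e hx he) (Set.toFinite _)

end Orders

/-- Lemma (multiple attractors): if the attraction subgraph of a routing-respecting
linear order has more than one global attractor, then there is another linear order on
the edges that respects the routing scheme and has a strictly smaller attraction
number. -/
theorem multiple_attractors_decrease_attractionNumber
    {V E : Type*} [Fintype V] [Nonempty V] [Fintype E] (src tgt : E → V)
    (hloop : ∀ e : E, src e ≠ tgt e) (hconn : StronglyConnected src tgt)
    (route : ∀ u w : V, u ≠ w → List E)
    (hroute : IsRouting src tgt route) (hdf : DeadlockFree route)
    (ord : LinearOrder E) (hresp : RespectsRouting route ord)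
    (v₁ v₂ : V) (hne : v₁ ≠ v₂)
    (hv₁ : IsGlobalAttractor src tgt (smallestEdges ord (attractionNumber src tgt ord)) v₁)
    (hv₂ : IsGlobalAttractor src tgt (smallestEdges ord (attractionNumber src tgt ord)) v₂) :
    ∃ ord' : LinearOrder E, RespectsRouting route ord' ∧
      attractionNumber src tgt ord' < attractionNumber src tgt ord := by
  obtain ⟨e₀, he₀, hsrc₀⟩ := (hv₂ v₁ hne).exists_edge_src
  set s := attractionNumber src tgt ord
  set A := smallestEdges ord s
  obtain ⟨f, ⟨hfA, hf⟩, hmax⟩ :=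
    Set.exists_max_image {e | e ∈ A ∧ IsGlobalAttractor src tgt A (src e)} id (Set.toFinite _)
      ⟨e₀, he₀, hsrc₀ ▸ hv₁⟩
  obtain ⟨ord', hinit, hlt⟩ := exists_linearOrder_initial ord (A \ {f})
  refine ⟨ord', fun e₁ e₂ hdep => hlt e₁ e₂ (hresp e₁ e₂ hdep) ?_, ?_⟩
  · rintro ⟨h₂, -⟩
    have hlt₁₂ := hresp e₁ e₂ hdep
    refine ⟨mem_smallestEdges_of_le (@le_of_lt E ord.toPreorder _ _ hlt₁₂) h₂, ?_⟩
    rintro rfl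
    obtain ⟨u, w, huw, hinf⟩ := hdep
    have htgt := (hroute u w huw).tgt_eq_src_of_infix hinf
    exact @not_le_of_gt E ord.toPreorder _ _ hlt₁₂ (hmax e₂ ⟨h₂, htgt ▸ hf.tgt_of_src hfA⟩)
  · calc attractionNumber src tgt ord' ≤ (A \ {f}).ncard :=
          Nat.sInf_le ⟨src f, hf.of_edges_leaving fun e he hne =>
            subset_smallestEdges_ncard hinit ⟨he, fun h => hne (congrArg src h)⟩⟩
      _ < A.ncard := Set.ncard_sdiff_singleton_lt_of_mem hfA (Set.toFinite _)
      _ ≤ s := ncard_smallestEdges_le ord s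
end

section
/- Let G = (V, E) be a finite directed multigraph, let ≤' be a linear order on E, let s ≥ 1, let E_s be the set of the s smallest edges of ≤', and let e be the s-th smallest edge (the maximum of E_s). If src e is a global attractor of the subgraph (V, E_s), then src e is already a global attractor of the subgraph (V, E_s \ {e}); hence the attraction number of ≤' is at most s − 1. -/
theorem ReachableVia.mono {V E : Type*} {src tgt : E → V} {A B : Set E} {u w : V}
    (hAB : A ⊆ B) (h : ReachableVia src tgt A u w) : ReachableVia src tgt B u w :=
  h.imp fun _ hp => ⟨fun e he => hAB (hp.1 e he), hp.2⟩

theorem IsGlobalAttractor.mono {V E : Type*} {src tgt : E → V} {A B : Set E} {v : V}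
    (hAB : A ⊆ B) (h : IsGlobalAttractor src tgt A v) : IsGlobalAttractor src tgt B v :=
  fun u hu => (h u hu).mono hAB

theorem ReachableVia.single {V E : Type*} {src tgt : E → V} {A : Set E} {a : E} (ha : a ∈ A) :
    ReachableVia src tgt A (src a) (tgt a) :=
  ⟨[a], by simpa using ha, by simp, List.isChain_singleton a, by simp, by simp⟩

theorem ReachableVia.cons {V E : Type*} {src tgt : E → V} {A : Set E} {a : E} {w : V}
    (ha : a ∈ A) (h : ReachableVia src tgt A (tgt a) w) : ReachableVia src tgt A (src a) w := by
  obtain ⟨p, hpA, hne, hchain, hhead, hlast⟩ := h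
  cases p with
  | nil => exact absurd rfl hne
  | cons b l =>
    have hb : src b = tgt a := by simpa using hhead
    refine ⟨a :: b :: l, ?_, by simp, ?_, by simp, ?_⟩
    · simpa [ha] using hpA
    · exact List.isChain_cons_cons.2 ⟨hb.symm, hchain⟩
    · simpa [List.getLast?_cons_cons] using hlast

/-- A path to `v` can avoid any edge with source `v`: cut it at its first visit to `v`. -/
theorem ReachableVia.diff_singleton {V E : Type*} {src tgt : E → V} {A : Set E} {e : E} {u : V}
    (hu : u ≠ src e) (h : ReachableVia src tgt A u (src e)) :
    ReachableVia src tgt (A \ {e}) u (src e) := by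
  obtain ⟨p, hpA, hne, hchain, hhead, hlast⟩ := h
  induction p generalizing u with
  | nil => exact absurd rfl hne
  | cons a l ih =>
    obtain rfl : src a = u := by simpa using hhead
    have ha : a ∈ A \ {e} := ⟨hpA a (by simp), by rintro rfl; exact hu rfl⟩
    by_cases hta : tgt a = src e
    · exact hta ▸ ReachableVia.single ha
    cases l with
    | nil => exact absurd (by simpa using hlast) hta
    | cons b l =>
      obtain ⟨hab, hbl⟩ := List.isChain_cons_cons.1 hchain
      refine ReachableVia.cons ha (ih hta (fun x hx => hpA x (List.mem_cons_of_mem a hx))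
        (by simp) hbl (by simp [hab]) ?_)
      simpa [List.getLast?_cons_cons] using hlast

theorem IsGlobalAttractor.diff_singleton {V E : Type*} {src tgt : E → V} {A : Set E} {e : E}
    (h : IsGlobalAttractor src tgt A (src e)) : IsGlobalAttractor src tgt (A \ {e}) (src e) :=
  fun u hu => (h u hu).diff_singleton hu

theorem smallestEdges_diff_max_subset {E : Type*} [Finite E] (ord : LinearOrder E) {s : ℕ} {e : E}
    (he : e ∈ smallestEdges ord s) (hmax : ∀ e' ∈ smallestEdges ord s, ord.le e' e) :
    smallestEdges ord s \ {e} ⊆ smallestEdges ord (s - 1) := by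
  rintro x ⟨hx, hxe⟩
  have hlt : x < e := lt_of_le_of_ne (hmax x hx) hxe
  have hcard : (Set.Iic x).ncard < (Set.Iic e).ncard :=
    Set.ncard_lt_ncard (Set.Iic_ssubset_Iic.2 hlt) (Set.toFinite _)
  exact Nat.le_sub_one_of_lt (hcard.trans_le he)

/-- If `e` is the `s`-th smallest edge (the maximum of the set `E_s` of the `s`
smallest edges) of a linear order and its source is a global attractor of `(V, E_s)`,
then its source is already a global attractor of `(V, E_s \ {e})`; hence the attraction
number of the order is at most `s - 1`. -/
theorem attractor_at_max_edge_source_decreases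
    {V E : Type*} [Fintype V] [Fintype E] (src tgt : E → V)
    (ord' : LinearOrder E) (s : ℕ) (hs : 1 ≤ s)
    (e : E) (he : e ∈ smallestEdges ord' s)
    (hmax : ∀ e' ∈ smallestEdges ord' s, ord'.le e' e)
    (hatt : IsGlobalAttractor src tgt (smallestEdges ord' s) (src e)) :
    IsGlobalAttractor src tgt (smallestEdges ord' s \ {e}) (src e) ∧
      attractionNumber src tgt ord' ≤ s - 1 := by
  have hdiff := hatt.diff_singleton
  exact ⟨hdiff, Nat.sInf_le ⟨src e, hdiff.mono (smallestEdges_diff_max_subset ord' he hmax)⟩⟩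
end
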